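/- There exist real constants C ≥ 1 and δ > 0 such that for every positive integer k and every nilpotent group G generated by some set of at most k elements, there exists a finite nonempty multiset A of elements of G with |A| ≤ C·k such that A has detection probability at least δ in G. -/

import Mathlib

open scoped Classical

/-- `A` has detection probability at least `δ` in `G`. -/
def Detects {G : Type*} [Group G] (A : Multiset G) (δ : ℝ) : Prop :=
  ∀ H : Subgroup G, H ≠ ⊤ →
    ((A.filter (fun a => a ∈ H)).card : ℝ) ≤ (1 - δ) * (Multiset.card A : ℝ)

lemma gv_card (p : ℕ) [Fact p.Prime] (k : ℕ) (v : Fin k → ZMod p) (hv : v ≠ 0) :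
    (Finset.univ.filter (fun a : Fin k → ZMod p => a ⬝ᵥ v = 0)).card * p ≤ p ^ k := by
  obtain ⟨j, hj⟩ := Function.ne_iff.mp hv
  have h := Finset.card_le_card_of_injOn
    (s := (Finset.univ.filter (fun a : Fin k → ZMod p => a ⬝ᵥ v = 0)) ×ˢ (Finset.univ : Finset (ZMod p)))
    (t := (Finset.univ : Finset (Fin k → ZMod p)))
    (fun x => x.1 + Pi.single j x.2) (by intro x _; simp) (by
      rintro ⟨a, t⟩ ha ⟨b, u⟩ hb hab
      simp at ha hb hab
      have h1 := congrArg (fun z => z ⬝ᵥ v) hab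
      simp [add_dotProduct, ha, hb, single_dotProduct] at h1
      have htu : t = u := by
        rcases h1 with h1 | h1
        · exact h1
        · exact absurd h1 hj
      subst htu
      simpa using hab)
  simpa [Finset.card_product, ZMod.card] using h

lemma gv_sum (p : ℕ) [Fact p.Prime] (k : ℕ) (v : Fin k → ZMod p) (hv : v ≠ 0) :
    ∑ a : Fin k → ZMod p, (if a ⬝ᵥ v = 0 then p ^ 2 else 1) ≤ p ^ k * (p + 1) := by
  have h : ∑ a : Fin k → ZMod p, (if a ⬝ᵥ v = 0 then p ^ 2 else 1) ≤
      ∑ a : Fin k → ZMod p, ((if a ⬝ᵥ v = 0 then p ^ 2 else 0) + 1) := by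
    apply Finset.sum_le_sum
    intro a _
    split_ifs <;> omega
  refine h.trans ?_
  rw [Finset.sum_add_distrib, ← Finset.sum_filter]
  simp only [Finset.sum_const, smul_eq_mul, Finset.card_univ, Fintype.card_pi, ZMod.card,
    Finset.prod_const, Fintype.card_fin]
  nlinarith [gv_card p k v hv, Nat.zero_le p]

lemma gv (p : ℕ) [Fact p.Prime] (k m : ℕ) : ∃ B : Fin m → Fin k → ZMod p,
    ∑ v ∈ Finset.univ.filter (fun v : Fin k → ZMod p => v ≠ 0),
      ∏ i, (if B i ⬝ᵥ v = 0 then p ^ 2 else 1) ≤ (p + 1) ^ m * p ^ k := by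
  induction m with
  | zero =>
    refine ⟨fun _ => 0, ?_⟩
    simp only [Finset.univ_eq_empty, Finset.prod_empty, Finset.sum_const, smul_eq_mul, mul_one,
      pow_zero, one_mul]
    refine (Finset.card_le_univ _).trans ?_
    simp [ZMod.card]
  | succ m ih =>
    obtain ⟨B, hB⟩ := ih
    obtain ⟨a, -, ha⟩ := Finset.exists_le_of_sum_le (s := (Finset.univ : Finset (Fin k → ZMod p)))
      (f := fun a => ∑ v ∈ Finset.univ.filter (fun v : Fin k → ZMod p => v ≠ 0),
        (if a ⬝ᵥ v = 0 then p ^ 2 else 1) * ∏ i, (if B i ⬝ᵥ v = 0 then p ^ 2 else 1))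
      (g := fun _ => (p + 1) ^ (m + 1) * p ^ k) Finset.univ_nonempty (by
        rw [Finset.sum_comm]
        simp only [← Finset.sum_mul, Finset.sum_const, smul_eq_mul, Finset.card_univ,
          Fintype.card_pi, ZMod.card, Finset.prod_const, Fintype.card_fin]
        calc _ ≤ ∑ v ∈ Finset.univ.filter (fun v : Fin k → ZMod p => v ≠ 0),
              (p ^ k * (p + 1)) * ∏ i, (if B i ⬝ᵥ v = 0 then p ^ 2 else 1) := by
              apply Finset.sum_le_sum
              intro v hv
              exact Nat.mul_le_mul_right _ (gv_sum p k v (Finset.mem_filter.mp hv).2)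
          _ ≤ (p ^ k * (p + 1)) * ((p + 1) ^ m * p ^ k) := by
              rw [← Finset.mul_sum]
              exact Nat.mul_le_mul_left _ hB
          _ = _ := by ring)
    refine ⟨Fin.cons a B, ?_⟩
    simpa [Fin.prod_univ_succ] using ha

lemma gv_code (p : ℕ) [Fact p.Prime] (k : ℕ) (hk : 0 < k) : ∃ B : Fin (8 * k) → Fin k → ZMod p,
    ∀ v : Fin k → ZMod p, v ≠ 0 →
      (Finset.univ.filter (fun i => B i ⬝ᵥ v = 0)).card ≤ 7 * k := by
  obtain ⟨B, hB⟩ := gv p k (8 * k)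
  refine ⟨B, fun v hv => ?_⟩
  by_contra! hc
  have hp : 2 ≤ p := (Fact.out : p.Prime).two_le
  have h1 : ∏ i, (if B i ⬝ᵥ v = 0 then p ^ 2 else 1) ≤ (p + 1) ^ (8 * k) * p ^ k :=
    (Finset.single_le_sum (f := fun v => ∏ i, (if B i ⬝ᵥ v = 0 then p ^ 2 else 1))
      (fun _ _ => Nat.zero_le _) (by simpa using hv)).trans hB
  rw [← Finset.prod_filter, Finset.prod_const] at h1
  have h2 : (p ^ 2) ^ (7 * k) ≤ (p + 1) ^ (8 * k) * p ^ k :=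
    (Nat.pow_le_pow_right (by positivity) hc.le).trans h1
  have h3 : (p + 1) ^ 8 * p < p ^ 14 := by
    have h4 : (2 * (p + 1)) ^ 8 ≤ (3 * p) ^ 8 := Nat.pow_le_pow_left (by omega) 8
    have h5 : 2 ^ 5 ≤ p ^ 5 := Nat.pow_le_pow_left hp 5
    rw [mul_pow, mul_pow] at h4
    have h6 : 0 < p ^ 8 := by positivity
    have h7 : (p + 1) ^ 8 < p ^ 8 * p ^ 5 := by nlinarith
    calc (p + 1) ^ 8 * p < (p ^ 8 * p ^ 5) * p := Nat.mul_lt_mul_of_pos_right h7 (by omega)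
      _ = p ^ 14 := by ring
  have h8 := Nat.pow_lt_pow_left h3 hk.ne'
  rw [mul_pow, ← pow_mul, ← pow_mul] at h8
  rw [← pow_mul] at h2
  have : 2 * (7 * k) = 14 * k := by ring
  rw [this] at h2
  omega

lemma rs_code (p : ℕ) [Fact p.Prime] (k m : ℕ) (hm : m ≤ p) (v : Fin k → ZMod p) (hv : v ≠ 0) :
    (Finset.univ.filter (fun i : Fin m => ∑ j : Fin k, ((i : ℕ) : ZMod p) ^ (j : ℕ) * v j = 0)).card
      ≤ k := by
  let f : Polynomial (ZMod p) := ∑ j : Fin k, Polynomial.monomial (j : ℕ) (v j)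
  have hcoeff : ∀ j : Fin k, f.coeff j = v j := by
    intro j
    simp [f, Polynomial.coeff_monomial, Fin.val_inj]
  have hf : f ≠ 0 := by
    intro h
    apply hv
    funext j
    rw [← hcoeff, h]; simp
  have hdeg : f.natDegree ≤ k := by
    apply Polynomial.natDegree_sum_le_of_forall_le
    intro j _
    exact (Polynomial.natDegree_monomial_le _).trans j.2.le
  refine le_trans ?_ ((Multiset.toFinset_card_le _).trans ((Polynomial.card_roots' f).trans hdeg))
  apply Finset.card_le_card_of_injOn (fun i : Fin m => ((i : ℕ) : ZMod p))
  · intro i hi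
    simp only [Finset.coe_filter, Finset.mem_univ, true_and, Set.mem_ofPred_eq] at hi
    simp only [Finset.mem_coe, Multiset.mem_toFinset, Polynomial.mem_roots hf, Polynomial.IsRoot.def]
    simp only [f, Polynomial.eval_finsetSum, Polynomial.eval_monomial]
    rw [← hi]
    exact Finset.sum_congr rfl fun _ _ => mul_comm _ _
  · intro i _ j _ hij
    have := (ZMod.natCast_eq_natCast_iff' _ _ _).mp hij
    rw [Nat.mod_eq_of_lt (by omega), Nat.mod_eq_of_lt (by omega)] at this
    exact Fin.ext this

lemma crt (n : ℕ) (x : ∀ p : ℕ, ZMod p) : ∃ z : ℕ, ∀ p, p.Prime → p < n → (z : ZMod p) = x p := by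
  let t := (Finset.range n).filter Nat.Prime
  have hc : Set.Pairwise (t : Set ℕ) (Function.onFun Nat.Coprime (fun p : ℕ => p)) := by
    intro p hp q hq hpq
    simp [t] at hp hq
    exact (Nat.coprime_primes hp.2 hq.2).mpr hpq
  have hs : ∀ i ∈ t, (fun p : ℕ => p) i ≠ 0 := by
    intro i hi
    simp [t] at hi
    exact hi.2.ne_zero
  let z := Nat.chineseRemainderOfFinset (fun p => (x p).val) (fun p => p) t hs hc
  refine ⟨z, fun p hp hpn => ?_⟩
  have h := z.2 p (by simp [t, hp, hpn])
  have h2 := (ZMod.natCast_eq_natCast_iff _ _ _).mpr h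
  have : NeZero p := ⟨hp.ne_zero⟩
  rw [h2]
  exact ZMod.natCast_zmod_val _

lemma universal_code (k : ℕ) (hk : 0 < k) : ∃ A : Fin (8 * k) ⊕ Fin (8 * k) → Fin k → ℕ,
    ∀ p : ℕ, p.Prime → ∀ v : Fin k → ZMod p, v ≠ 0 →
      (Finset.univ.filter (fun i => ∑ j, (A i j : ZMod p) * v j = 0)).card ≤ 15 * k := by
  have hB : ∀ p : ℕ, ∃ B : Fin (8 * k) → Fin k → ZMod p, p.Prime → ∀ v : Fin k → ZMod p, v ≠ 0 →
      (Finset.univ.filter (fun i => B i ⬝ᵥ v = 0)).card ≤ 7 * k := by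
    intro p
    by_cases hp : p.Prime
    · have := Fact.mk hp
      obtain ⟨B, hB⟩ := gv_code p k hk
      exact ⟨B, fun _ => hB⟩
    · exact ⟨fun _ _ => 0, fun h => absurd h hp⟩
  choose B hB using hB
  choose Z hZ using fun i j => crt (8 * k) (fun p => B p i j)
  refine ⟨Sum.elim (fun i j => (i : ℕ) ^ (j : ℕ)) Z, fun p hp v hv => ?_⟩
  have := Fact.mk hp
  rw [Finset.card_filter, Fintype.sum_sum_type, ← Finset.card_filter, ← Finset.card_filter]
  simp only [Sum.elim_inl, Sum.elim_inr]
  have c1 : (Finset.univ.filter (fun i : Fin (8*k) =>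
      ∑ j : Fin k, (((i : ℕ) ^ (j : ℕ) : ℕ) : ZMod p) * v j = 0)).card ≤ 8 * k := by
    simpa using Finset.card_le_univ (Finset.univ.filter (fun i : Fin (8*k) =>
      ∑ j : Fin k, (((i : ℕ) ^ (j : ℕ) : ℕ) : ZMod p) * v j = 0))
  have c2 : (Finset.univ.filter (fun i : Fin (8*k) =>
      ∑ j, (Z i j : ZMod p) * v j = 0)).card ≤ 8 * k := by
    simpa using Finset.card_le_univ (Finset.univ.filter (fun i : Fin (8*k) =>
      ∑ j, (Z i j : ZMod p) * v j = 0))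
  have main : (Finset.univ.filter (fun i : Fin (8*k) =>
      ∑ j : Fin k, (((i : ℕ) ^ (j : ℕ) : ℕ) : ZMod p) * v j = 0)).card +
      (Finset.univ.filter (fun i : Fin (8*k) =>
      ∑ j, (Z i j : ZMod p) * v j = 0)).card ≤ 15 * k := by
    by_cases h : p < 8 * k
    · have c3 : (Finset.univ.filter (fun i : Fin (8*k) =>
        ∑ j, (Z i j : ZMod p) * v j = 0)).card ≤ 7 * k := by
        refine (Finset.card_le_card ?_).trans (hB p hp v hv)
        intro i hi
        rw [Finset.mem_filter] at hi ⊢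
        refine ⟨Finset.mem_univ _, ?_⟩
        rw [dotProduct, ← hi.2]
        exact Finset.sum_congr rfl fun j _ => by rw [hZ i j p hp h]
      omega
    · have c3 := rs_code p k (8 * k) (by omega) v hv
      simp only [← Nat.cast_pow] at c3
      omega
  refine le_trans (le_of_eq ?_) main
  congr 2

lemma exists_coatom {G : Type*} [Group G] (S : Finset G)
    (hS : Subgroup.closure (S : Set G) = ⊤) (H : Subgroup G) (hH : H ≠ ⊤) :
    ∃ M : Subgroup G, IsCoatom M ∧ H ≤ M := by
  have hc : IsCompactElement (⊤ : Subgroup G) := by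
    rw [CompleteLattice.isCompactElement_iff_le_of_directed_sSup_le]
    intro s hne hdir htop
    have h1 : ∀ g ∈ S, ∃ K ∈ s, g ∈ K := fun g _ =>
      (Subgroup.mem_sSup_of_directedOn hne hdir).mp (htop (Subgroup.mem_top g))
    have h2 : ∀ T : Finset G, T ⊆ S → ∃ K ∈ s, (T : Set G) ⊆ K := by
      intro T
      induction T using Finset.induction_on with
      | empty => intro _; obtain ⟨K, hK⟩ := hne; exact ⟨K, hK, by simp⟩
      | insert a T ha ih =>
        intro hT
        obtain ⟨K, hK, hTK⟩ := ih fun x hx => hT (Finset.mem_insert_of_mem hx)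
        obtain ⟨L, hL, haL⟩ := h1 a (hT (Finset.mem_insert_self a T))
        obtain ⟨P, hP, hKP, hLP⟩ := hdir K hK L hL
        refine ⟨P, hP, ?_⟩
        intro x hx
        rcases Finset.mem_insert.mp (Finset.mem_coe.mp hx) with rfl | hx
        · exact hLP haL
        · exact hKP (hTK hx)
    obtain ⟨K, hK, hSK⟩ := h2 S subset_rfl
    exact ⟨K, hK, hS ▸ (Subgroup.closure_le K).mpr hSK⟩
  have := CompleteLattice.coatomic_of_top_compact hc
  exact (eq_top_or_exists_le_coatom H).resolve_left hH

lemma exists_hom {G : Type*} [Group G] [Group.IsNilpotent G] (M : Subgroup G) (hM : IsCoatom M) :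
    ∃ p : ℕ, p.Prime ∧ ∃ φ : G →* Multiplicative (ZMod p), φ.ker = M := by
  have hn : M.Normal :=
    Subgroup.NormalizerCondition.normal_of_coatom M Group.normalizerCondition_of_isNilpotent hM
  have hnt : Nontrivial (G ⧸ M) := QuotientGroup.nontrivial_iff.mpr hM.1
  have hsimple : IsSimpleGroup (G ⧸ M) := by
    refine ⟨fun K _ => ?_⟩
    have hle : M ≤ K.comap (QuotientGroup.mk' M) := by
      intro x hx
      rw [Subgroup.mem_comap]
      have : QuotientGroup.mk' M x = 1 := (QuotientGroup.eq_one_iff x).mpr hx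
      rw [this]; exact K.one_mem
    have hmap := Subgroup.map_comap_eq_self_of_surjective (QuotientGroup.mk'_surjective M) K
    rcases hM.le_iff.mp hle with h | h
    · right
      rw [← hmap, h]
      exact Subgroup.map_top_of_surjective _ (QuotientGroup.mk'_surjective M)
    · left
      rw [← hmap, h]
      exact (Subgroup.map_eq_bot_iff _).mpr (by simp)
  have hcyc : IsCyclic (G ⧸ M) := inferInstance
  have hp : (Nat.card (G ⧸ M)).Prime := by
    let _ : CommGroup (G ⧸ M) := IsCyclic.commGroup
    exact IsSimpleGroup.prime_card
  refine ⟨_, hp, (zmodCyclicMulEquiv hcyc).symm.toMonoidHom.comp (QuotientGroup.mk' M), ?_⟩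
  ext x
  simp [MonoidHom.mem_ker]

theorem stmt16 :
    ∃ C δ : ℝ, 1 ≤ C ∧ 0 < δ ∧
      ∀ k : ℕ, 0 < k → ∀ (G : Type*) [Group G] [Group.IsNilpotent G],
        (∃ S : Finset G, S.card ≤ k ∧ Subgroup.closure (S : Set G) = ⊤) →
        ∃ A : Multiset G, A ≠ 0 ∧ (Multiset.card A : ℝ) ≤ C * k ∧ Detects A δ := by
  refine ⟨16, 1 / 16, by norm_num, by norm_num, ?_⟩
  intro k hk G _ _ ⟨S, hSk, hS⟩
  have hk1 : (1 : ℝ) ≤ k := by exact_mod_cast hk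
  rcases Nat.eq_zero_or_pos S.card with h0 | hpos
  · refine ⟨{1}, by simp, by simp; linarith, ?_⟩
    intro H hH
    exfalso
    apply hH
    rw [Finset.card_eq_zero] at h0
    subst h0
    simp at hS
    rw [eq_top_iff, ← hS]
    exact bot_le
  obtain ⟨A, hA⟩ := universal_code S.card hpos
  let s : Fin S.card → G := fun i => (S.equivFin.symm i : G)
  let w : Fin (8 * S.card) ⊕ Fin (8 * S.card) → G := fun i => (List.ofFn fun j => s j ^ A i j).prod
  have hcard : Multiset.card ((Finset.univ : Finset (Fin (8 * S.card) ⊕ Fin (8 * S.card))).val.map w)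
      = 16 * S.card := by
    simp; ring
  refine ⟨Finset.univ.val.map w, ?_, ?_, ?_⟩
  · rw [← Multiset.card_pos, hcard]; omega
  · rw [hcard]
    have : (S.card : ℝ) ≤ k := by exact_mod_cast hSk
    push_cast; linarith
  intro H hH
  obtain ⟨M, hM, hHM⟩ := exists_coatom S hS H hH
  obtain ⟨p, hp, φ, hφ⟩ := exists_hom M hM
  let v : Fin S.card → ZMod p := fun j => Multiplicative.toAdd (φ (s j))
  have hv : v ≠ 0 := by
    intro hv
    apply hM.1
    rw [eq_top_iff, ← hS, Subgroup.closure_le]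
    intro g hg
    have h1 := congrFun hv (S.equivFin ⟨g, hg⟩)
    simp only [v, s, Equiv.symm_apply_apply, Pi.zero_apply, toAdd_eq_zero] at h1
    rw [← hφ]
    exact h1
  have hw : ∀ i, w i ∈ H → ∑ j, (A i j : ZMod p) * v j = 0 := by
    intro i hi
    have h1 : φ (w i) = 1 := by
      have : w i ∈ φ.ker := hφ ▸ hHM hi
      exact this
    have h2 : φ (w i) = Multiplicative.ofAdd (∑ j, (A i j : ZMod p) * v j) := by
      simp only [w, map_list_prod, List.map_ofFn, List.prod_ofFn, ofAdd_sum]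
      refine Finset.prod_congr rfl fun j _ => ?_
      simp only [Function.comp, map_pow, v, ← nsmul_eq_mul, ofAdd_nsmul, ofAdd_toAdd]
    rw [h2] at h1
    exact ofAdd_eq_one.mp h1
  have hle : Multiset.card ((Finset.univ.val.map w).filter (fun a => a ∈ H)) ≤ 15 * S.card := by
    rw [Multiset.filter_map, Multiset.card_map]
    refine le_trans ?_ (hA p hp v hv)
    refine Multiset.card_le_card (s := Multiset.filter ((fun a => a ∈ H) ∘ w) Finset.univ.val) (
      Multiset.monotone_filter_right _ ?_)
    intro i hi
    exact hw i hi
  rw [hcard]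
  have : (Multiset.card ((Finset.univ.val.map w).filter (fun a => a ∈ H)) : ℝ) ≤ 15 * S.card := by
    exact_mod_cast hle
  push_cast
  linarith
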